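/- arXiv:1011.2443 — 2 statements merged into one kernel-verified Lean document; each statement's English description precedes it below -/
import Mathlib

section
/- Let K ≥ 2 be an integer, T > 0, and let x, x̃ ∈ C([0,T],ℝ^{K−1}) satisfy x_j(0) ≥ 0 and x̃_j(0) ≥ 0 for all j. Suppose (y,z) is a solution of the Skorokhod problem for x with reflection matrix Q^{(K−1)} and (ỹ,z̃) is a solution of the Skorokhod problem for x̃ with reflection matrix Q^{(K−1)}. Then ‖y − ỹ‖_{T,max} ≤ 2(K−1)² · ‖x − x̃‖_{T,max}. -/
open scoped BigOperators

/-- `(y,z)` solves the Skorokhod problem on `[0,T]` for the input path `x` with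
the tridiagonal reflection matrix `Q^{(K−1)}` (entries `1/2` off the diagonal).
Paths are indexed by `j = 1,…,K−1`, with the convention `y_0 ≡ 0`, `y_K ≡ 0`. -/
def IsSkorokhodSolution (K : ℕ) (T : ℝ) (x y z : ℝ → ℕ → ℝ) : Prop :=
  (∀ j ∈ Finset.Icc 1 (K - 1), ContinuousOn (fun t => y t j) (Set.Icc 0 T) ∧
      ContinuousOn (fun t => z t j) (Set.Icc 0 T)) ∧
  (∀ t : ℝ, y t 0 = 0) ∧ (∀ t : ℝ, y t K = 0) ∧
  (∀ t ∈ Set.Icc (0 : ℝ) T, ∀ j ∈ Finset.Icc 1 (K - 1),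
    z t j = x t j + y t j - (1 / 2) * y t (j - 1) - (1 / 2) * y t (j + 1)) ∧
  (∀ t ∈ Set.Icc (0 : ℝ) T, ∀ j ∈ Finset.Icc 1 (K - 1), 0 ≤ z t j) ∧
  (∀ j ∈ Finset.Icc 1 (K - 1),
    MonotoneOn (fun t => y t j) (Set.Icc 0 T) ∧ y 0 j = 0) ∧
  (∀ j ∈ Finset.Icc 1 (K - 1), ∀ a b : ℝ, 0 ≤ a → a ≤ b → b ≤ T →
    (∀ t ∈ Set.Icc a b, 0 < z t j) → ∀ t ∈ Set.Icc a b, y t j = y a j)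

/-- The `‖·‖_{T,max}` norm of a path indexed by `1,…,K−1`. -/
noncomputable def normTmax (T : ℝ) (K : ℕ) (f : ℝ → ℕ → ℝ) : ℝ :=
  ⨆ j : Finset.Icc 1 (K - 1), ⨆ t : Set.Icc (0 : ℝ) T, |f t.1 (j : ℕ)|

/-- If `y` only grows while the nonnegative path `z` vanishes, then any growth of `y` up to time `t`
already happened at a zero of `z`. -/
theorem exists_zero_of_pos_growth {T : ℝ} {y z : ℝ → ℝ}
    (hy : ContinuousOn y (Set.Icc 0 T)) (hz : ContinuousOn z (Set.Icc 0 T))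
    (hz0 : ∀ t ∈ Set.Icc (0 : ℝ) T, 0 ≤ z t)
    (hflat : ∀ a b : ℝ, 0 ≤ a → a ≤ b → b ≤ T →
      (∀ t ∈ Set.Icc a b, 0 < z t) → ∀ t ∈ Set.Icc a b, y t = y a)
    {t : ℝ} (ht : t ∈ Set.Icc (0 : ℝ) T) (hyt : y 0 < y t) :
    ∃ s ∈ Set.Icc (0 : ℝ) t, z s = 0 ∧ y s = y t := by
  have hsub : Set.Icc 0 t ⊆ Set.Icc 0 T := Set.Icc_subset_Icc_right ht.2
  have hcl : IsClosed (Set.Icc 0 t ∩ z ⁻¹' {0}) :=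
    (hz.mono hsub).preimage_isClosed_of_isClosed isClosed_Icc isClosed_singleton
  have hcpt : IsCompact (Set.Icc 0 t ∩ z ⁻¹' {0}) :=
    isCompact_Icc.of_isClosed_subset hcl Set.inter_subset_left
  have hne : (Set.Icc 0 t ∩ z ⁻¹' {0}).Nonempty := by
    by_contra hemp
    have hpos : ∀ r ∈ Set.Icc 0 t, 0 < z r := fun r hr =>
      lt_of_le_of_ne (hz0 r (hsub hr)) fun h => hemp ⟨r, hr, h.symm⟩
    exact hyt.ne' (hflat 0 t le_rfl ht.1 ht.2 hpos t ⟨ht.1, le_rfl⟩)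
  obtain ⟨s, ⟨hs, hzs⟩, hmax⟩ := hcpt.exists_isGreatest hne
  refine ⟨s, hs, hzs, ?_⟩
  rcases hs.2.eq_or_lt with rfl | hst
  · rfl
  have hconst : ∀ r ∈ Set.Ioc s t, y t = y r := by
    intro r hr
    have hr0 : 0 ≤ r := hs.1.trans hr.1.le
    refine hflat r t hr0 hr.2 ht.2 (fun u hu => ?_) t ⟨hr.2, le_rfl⟩
    have hu' : u ∈ Set.Icc 0 t := ⟨hr0.trans hu.1, hu.2⟩
    refine lt_of_le_of_ne (hz0 u (hsub hu')) fun h => ?_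
    exact (hr.1.trans_le hu.1).not_ge (hmax ⟨hu', h.symm⟩)
  have hlim : Filter.Tendsto y (nhdsWithin s (Set.Ioc s t)) (nhds (y s)) :=
    (hy s (hsub hs)).mono fun r hr => hsub ⟨hs.1.trans hr.1.le, hr.2⟩
  have hlim' : Filter.Tendsto y (nhdsWithin s (Set.Ioc s t)) (nhds (y t)) :=
    tendsto_const_nhds.congr' (Filter.eventually_of_mem self_mem_nhdsWithin hconst)
  have : (nhdsWithin s (Set.Ioc s t)).NeBot := by
    rw [nhdsWithin_Ioc_eq_nhdsGT hst]
    infer_instance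
  exact tendsto_nhds_unique hlim hlim'

/-- Discrete maximum principle: a subharmonic sequence on `0, …, n` with nonpositive boundary values
is nonpositive. -/
theorem nonpos_of_le_half_add {n : ℕ} {e : ℕ → ℝ} (h0 : e 0 ≤ 0) (hn : e n ≤ 0)
    (he : ∀ j, 0 < j → j < n → e j ≤ (1 / 2) * e (j - 1) + (1 / 2) * e (j + 1)) :
    ∀ j ≤ n, e j ≤ 0 := by
  classical
  obtain ⟨m, hm, hmax⟩ := (Finset.range (n + 1)).exists_max_image e ⟨0, by simp⟩
  have hex : ∃ m, m ≤ n ∧ ∀ i ≤ n, e i ≤ e m :=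
    ⟨m, by simpa [Nat.lt_succ_iff] using hm,
      fun i hi => hmax i (by simpa [Nat.lt_succ_iff] using hi)⟩
  obtain ⟨hle, hfirst⟩ := Nat.find_spec hex
  have hmin : ∀ i < Nat.find hex, ¬(i ≤ n ∧ ∀ l ≤ n, e l ≤ e i) := fun i hi => Nat.find_min hex hi
  generalize Nat.find hex = k at hle hfirst hmin
  suffices hk : e k ≤ 0 from fun j hj => (hfirst j hj).trans hk
  rcases Nat.eq_zero_or_pos k with rfl | hkpos
  · exact h0
  rcases hle.eq_or_lt with rfl | hkn
  · exact hn
  have hlt : e (k - 1) < e k := by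
    by_contra! hge
    exact hmin (k - 1) (by omega) ⟨by omega, fun l hl => (hfirst l hl).trans hge⟩
  linarith [he k hkpos hkn, hfirst (k + 1) hkn]

/-- Any solution exceeds another one, in each coordinate, by at most the average of the neighbouring
discrepancies plus the discrepancy of the inputs. -/
theorem IsSkorokhodSolution.sub_le {K : ℕ} {T : ℝ} {x x' y y' z z' : ℝ → ℕ → ℝ}
    (h : IsSkorokhodSolution K T x y z) (h' : IsSkorokhodSolution K T x' y' z')
    {j : ℕ} (hj : j ∈ Finset.Icc 1 (K - 1)) {ε a b : ℝ}
    (hε : ∀ t ∈ Set.Icc (0 : ℝ) T, |x t j - x' t j| ≤ ε)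
    (ha : ∀ t ∈ Set.Icc (0 : ℝ) T, |y t (j - 1) - y' t (j - 1)| ≤ a)
    (hb : ∀ t ∈ Set.Icc (0 : ℝ) T, |y t (j + 1) - y' t (j + 1)| ≤ b)
    {t : ℝ} (ht : t ∈ Set.Icc (0 : ℝ) T) :
    y t j - y' t j ≤ (1 / 2) * a + (1 / 2) * b + ε := by
  obtain ⟨hc, -, -, heq, hnn, hmono, hflat⟩ := h
  obtain ⟨-, -, -, heq', hnn', hmono', -⟩ := h'
  by_contra! hgt
  have h0T : (0 : ℝ) ∈ Set.Icc (0 : ℝ) T := ⟨le_rfl, ht.1.trans ht.2⟩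
  have hε0 := (abs_nonneg _).trans (hε t ht)
  have ha0 := (abs_nonneg _).trans (ha t ht)
  have hb0 := (abs_nonneg _).trans (hb t ht)
  have hy't : y' 0 j ≤ y' t j := (hmono' j hj).1 h0T ht ht.1
  have hyt : y 0 j < y t j := by linarith [(hmono j hj).2, (hmono' j hj).2]
  obtain ⟨s, hs, hzs, hys⟩ := exists_zero_of_pos_growth (y := fun t => y t j)
    (z := fun t => z t j) (hc j hj).1 (hc j hj).2 (fun t ht => hnn t ht j hj) (hflat j hj) ht hyt
  have hsT : s ∈ Set.Icc (0 : ℝ) T := ⟨hs.1, hs.2.trans ht.2⟩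
  have hy's : y' s j ≤ y' t j := (hmono' j hj).1 hsT ht hs.2
  have hz's := hnn' s hsT j hj
  rw [heq s hsT j hj] at hzs
  rw [heq' s hsT j hj] at hz's
  linarith [neg_le_of_abs_le (hε s hsT), le_of_abs_le (ha s hsT), le_of_abs_le (hb s hsT)]

/-- the local time part of the Skorokhod map for `Q^{(K−1)}` is
Lipschitz with constant `2(K−1)²` in the `‖·‖_{T,max}` norm. -/
theorem skorokhod_local_time_lipschitz_Tmax
    (K : ℕ) (hK : 2 ≤ K) (T : ℝ) (hT : 0 < T)
    (x x' y y' z z' : ℝ → ℕ → ℝ)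
    (hx : ∀ j ∈ Finset.Icc 1 (K - 1), ContinuousOn (fun t => x t j) (Set.Icc 0 T))
    (hx' : ∀ j ∈ Finset.Icc 1 (K - 1), ContinuousOn (fun t => x' t j) (Set.Icc 0 T))
    (hx0 : ∀ j ∈ Finset.Icc 1 (K - 1), 0 ≤ x 0 j)
    (hx0' : ∀ j ∈ Finset.Icc 1 (K - 1), 0 ≤ x' 0 j)
    (hsol : IsSkorokhodSolution K T x y z)
    (hsol' : IsSkorokhodSolution K T x' y' z') :
    normTmax T K (fun t j => y t j - y' t j) ≤
      2 * ((K : ℝ) - 1) ^ 2 * normTmax T K (fun t j => x t j - x' t j) := by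
  have bdd : ∀ f : ℝ → ℝ, ContinuousOn f (Set.Icc 0 T) →
      BddAbove (Set.range fun t : Set.Icc (0 : ℝ) T => |f t|) := by
    intro f hf
    have := isCompact_Icc.bddAbove_image hf.abs
    rwa [Set.image_eq_range] at this
  have : Nonempty (Set.Icc (0 : ℝ) T) := ⟨⟨0, le_rfl, hT.le⟩⟩
  have : Nonempty (Finset.Icc 1 (K - 1)) := ⟨⟨1, by simp; omega⟩⟩
  set ε := normTmax T K (fun t j => x t j - x' t j) with hεdef
  have hε : ∀ j ∈ Finset.Icc 1 (K - 1), ∀ t ∈ Set.Icc (0 : ℝ) T, |x t j - x' t j| ≤ ε := by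
    intro j hj t ht
    refine (le_ciSup (bdd _ ((hx j hj).sub (hx' j hj))) ⟨t, ht⟩).trans ?_
    exact le_ciSup (f := fun j : Finset.Icc 1 (K - 1) =>
      ⨆ t : Set.Icc (0 : ℝ) T, |x t.1 j - x' t.1 j|) (Set.finite_range _).bddAbove ⟨j, hj⟩
  have hε0 : 0 ≤ ε := (abs_nonneg _).trans (hε 1 (by simp; omega) 0 ⟨le_rfl, hT.le⟩)
  let D : ℕ → ℝ := fun j => ⨆ t : Set.Icc (0 : ℝ) T, |y t j - y' t j|
  have hD0 : D 0 = 0 := by simp [D, hsol.2.1, hsol'.2.1]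
  have hDK : D K = 0 := by simp [D, hsol.2.2.1, hsol'.2.2.1]
  have hD : ∀ j ≤ K, ∀ t ∈ Set.Icc (0 : ℝ) T, |y t j - y' t j| ≤ D j := by
    intro j hj t ht
    rcases Nat.eq_zero_or_pos j with rfl | hj0
    · simp [hD0, hsol.2.1, hsol'.2.1]
    rcases hj.eq_or_lt with rfl | hjK
    · simp [hDK, hsol.2.2.1, hsol'.2.2.1]
    have hj' : j ∈ Finset.Icc 1 (K - 1) := Finset.mem_Icc.2 ⟨hj0, by omega⟩
    exact le_ciSup (bdd _ ((hsol.1 j hj').1.sub (hsol'.1 j hj').1)) ⟨t, ht⟩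
  have hrec : ∀ j, 0 < j → j < K → D j ≤ (1 / 2) * D (j - 1) + (1 / 2) * D (j + 1) + ε := by
    intro j hj0 hjK
    have hj' : j ∈ Finset.Icc 1 (K - 1) := Finset.mem_Icc.2 ⟨hj0, by omega⟩
    refine ciSup_le fun t => abs_sub_le_iff.2 ⟨?_, ?_⟩
    · exact hsol.sub_le hsol' hj' (hε j hj') (hD _ (by omega)) (hD _ hjK) t.2
    · refine hsol'.sub_le hsol hj' (fun s hs => ?_) (fun s hs => ?_) (fun s hs => ?_) t.2
      · rw [abs_sub_comm]; exact hε j hj' s hs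
      · rw [abs_sub_comm]; exact hD _ (by omega) s hs
      · rw [abs_sub_comm]; exact hD _ hjK s hs
  have hDle := nonpos_of_le_half_add (n := K) (e := fun j => D j - ε * (j * (K - j)))
    (by simp [hD0]) (by simp [hDK]) (fun j hj0 hjK => by
      have := hrec j hj0 hjK
      push_cast [Nat.cast_sub hj0]
      linarith)
  refine ciSup_le fun j => ?_
  have hjmem := Finset.mem_Icc.1 j.2
  have hDj : D j ≤ ε * (j * (K - j)) := sub_nonpos.1 (hDle j (by omega))
  have hK' : (2 : ℝ) ≤ K := by exact_mod_cast hK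
  have hquad : ((j : ℕ) : ℝ) * (K - (j : ℕ)) ≤ 2 * ((K : ℝ) - 1) ^ 2 := by
    nlinarith [sq_nonneg ((K : ℝ) - 2 * (j : ℕ)), mul_nonneg (sub_nonneg.2 hK') (sub_nonneg.2 hK')]
  calc D j ≤ ε * (j * (K - j)) := hDj
    _ ≤ ε * (2 * ((K : ℝ) - 1) ^ 2) := mul_le_mul_of_nonneg_left hquad hε0
    _ = 2 * ((K : ℝ) - 1) ^ 2 * ε := mul_comm _ _
end

section
/- Let K ≥ 2 be an integer, T > 0, and let x, x̃ ∈ C([0,T],ℝ^{K−1}) satisfy x_j(0) ≥ 0 and x̃_j(0) ≥ 0 for all j. Suppose (y,z) is a solution of the Skorokhod problem for x with reflection matrix Q^{(K−1)} and (ỹ,z̃) is a solution of the Skorokhod problem for x̃ with reflection matrix Q^{(K−1)}. Then ‖z − z̃‖_{T,max} ≤ ‖x − x̃‖_{T,max} + 2‖y − ỹ‖_{T,max} ≤ (1 + 4(K−1)²) · ‖x − x̃‖_{T,max} ≤ 5(K−1)² · ‖x − x̃‖_{T,max}. -/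
open scoped BigOperators

/-- A discrete maximum principle: a midpoint-convex sequence on `{0,…,K}` that vanishes at
both ends is nonpositive. -/
theorem nonpos_of_midpoint_convex {K : ℕ} {u : ℕ → ℝ} (h0 : u 0 = 0) (hK : u K = 0)
    (hu : ∀ j, j + 2 ≤ K → u (j + 1) ≤ (1 / 2) * u j + (1 / 2) * u (j + 2)) :
    ∀ j ≤ K, u j ≤ 0 := by
  have key : ∀ j, j + 1 ≤ K → ((j : ℝ) + 1) * u j ≤ j * u (j + 1) := by
    intro j
    induction j with
    | zero => intro _; simp [h0]
    | succ j ih =>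
      intro hj
      have h1 := ih (by omega)
      have h2 := mul_le_mul_of_nonneg_left (hu j (by omega)) (by positivity : (0 : ℝ) ≤ j + 1)
      push_cast
      linarith
  intro j hj
  induction hj using Nat.decreasingInduction with
  | self => exact hK.le
  | of_succ j hj ih =>
    have h1 := key j hj
    have h2 := mul_nonpos_of_nonneg_of_nonpos (Nat.cast_nonneg (α := ℝ) j) ih
    exact nonpos_of_mul_nonpos_right (h1.trans h2) (by positivity)

/-- If `g` is constant on the subintervals where `f` is positive, then either `g t` is the
initial value of `g`, or it is attained at a zero of `f` before time `t`. -/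
theorem eq_initial_or_exists_zero_eq {T t : ℝ} {f g : ℝ → ℝ}
    (hf : ContinuousOn f (Set.Icc 0 T)) (hg : ContinuousOn g (Set.Icc 0 T))
    (hf0 : ∀ s ∈ Set.Icc 0 T, 0 ≤ f s)
    (hflat : ∀ a b : ℝ, 0 ≤ a → a ≤ b → b ≤ T →
      (∀ s ∈ Set.Icc a b, 0 < f s) → ∀ s ∈ Set.Icc a b, g s = g a)
    (ht : t ∈ Set.Icc 0 T) :
    g t = g 0 ∨ ∃ s ∈ Set.Icc 0 t, f s = 0 ∧ g t = g s := by
  have hsub : Set.Icc 0 t ⊆ Set.Icc 0 T := Set.Icc_subset_Icc_right ht.2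
  by_cases hne : ∃ s ∈ Set.Icc 0 t, f s = 0
  · right
    have hcomp : IsCompact (Set.Icc 0 t ∩ f ⁻¹' {0}) :=
      isCompact_Icc.of_isClosed_subset
        ((hf.mono hsub).preimage_isClosed_of_isClosed isClosed_Icc isClosed_singleton)
        Set.inter_subset_left
    obtain ⟨s, ⟨hs, hfs⟩, hmax⟩ := hcomp.exists_isGreatest hne
    refine ⟨s, hs, hfs, ?_⟩
    rcases hs.2.eq_or_lt with rfl | hst
    · rfl
    have hconst : ∀ r ∈ Set.Ioc s t, g t = g r := by
      intro r hr
      refine hflat r t (hs.1.trans hr.1.le) hr.2 ht.2 (fun q hq => ?_) t ⟨hr.2, le_rfl⟩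
      have hq' : q ∈ Set.Icc 0 t := ⟨hs.1.trans (hr.1.le.trans hq.1), hq.2⟩
      refine (hf0 q (hsub hq')).lt_of_ne' fun h => ?_
      exact absurd (hmax ⟨hq', h⟩) (not_le.2 (hr.1.trans_le hq.1))
    have hlim : Filter.Tendsto g (nhdsWithin s (Set.Ioc s t)) (nhds (g s)) :=
      (hg s (hsub hs)).mono fun r hr => ⟨hs.1.trans hr.1.le, hr.2.trans ht.2⟩
    have hlim' : Filter.Tendsto g (nhdsWithin s (Set.Ioc s t)) (nhds (g t)) :=
      tendsto_const_nhds.congr' (eventually_nhdsWithin_of_forall hconst)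
    have : (nhdsWithin s (Set.Ioc s t)).NeBot := by
      rw [nhdsWithin_Ioc_eq_nhdsGT hst]; infer_instance
    exact tendsto_nhds_unique hlim' hlim
  · left
    push Not at hne
    exact hflat 0 t le_rfl ht.1 ht.2
      (fun s hs => (hf0 s (hsub hs)).lt_of_ne' (hne s hs)) t ⟨ht.1, le_rfl⟩

theorem abs_le_iSup_abs_of_continuousOn {T t : ℝ} {f : ℝ → ℝ}
    (hf : ContinuousOn f (Set.Icc 0 T)) (ht : t ∈ Set.Icc 0 T) :
    |f t| ≤ ⨆ s : Set.Icc (0 : ℝ) T, |f s| := by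
  refine le_ciSup (f := fun s : Set.Icc (0 : ℝ) T => |f s|) ?_ ⟨t, ht⟩
  have := isCompact_Icc.bddAbove_image hf.abs
  rwa [Set.image_eq_range] at this

theorem abs_le_normTmax {T t : ℝ} {K j : ℕ} {f : ℝ → ℕ → ℝ}
    (hf : ∀ j ∈ Finset.Icc 1 (K - 1), ContinuousOn (fun t => f t j) (Set.Icc 0 T))
    (ht : t ∈ Set.Icc 0 T) (hj : j ∈ Finset.Icc 1 (K - 1)) :
    |f t j| ≤ normTmax T K f :=
  (abs_le_iSup_abs_of_continuousOn (hf j hj) ht).trans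
    (le_ciSup (f := fun j : Finset.Icc 1 (K - 1) => ⨆ t : Set.Icc (0 : ℝ) T, |f t.1 (j : ℕ)|)
      (Set.finite_range _).bddAbove ⟨j, hj⟩)

theorem normTmax_nonneg (T : ℝ) (K : ℕ) (f : ℝ → ℕ → ℝ) : 0 ≤ normTmax T K f :=
  Real.iSup_nonneg fun _ => Real.iSup_nonneg fun _ => abs_nonneg _

theorem normTmax_le {T C : ℝ} {K : ℕ} {f : ℝ → ℕ → ℝ} (hC : 0 ≤ C)
    (h : ∀ t ∈ Set.Icc 0 T, ∀ j ∈ Finset.Icc 1 (K - 1), |f t j| ≤ C) :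
    normTmax T K f ≤ C :=
  Real.iSup_le (fun j => Real.iSup_le (fun t => h t t.2 j j.2) hC) hC

/-- One-sided comparison of the regulators of two Skorokhod problems in one coordinate, given
bounds for the two neighbouring coordinates. -/
theorem IsSkorokhodSolution.regulator_sub_le {K : ℕ} {T : ℝ} {x x' y y' z z' : ℝ → ℕ → ℝ}
    (hsol : IsSkorokhodSolution K T x y z) (hsol' : IsSkorokhodSolution K T x' y' z')
    {j : ℕ} (hj : j ∈ Finset.Icc 1 (K - 1)) {ε A B : ℝ}
    (hε : ∀ t ∈ Set.Icc 0 T, |x t j - x' t j| ≤ ε)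
    (hA : ∀ t ∈ Set.Icc 0 T, |y t (j - 1) - y' t (j - 1)| ≤ A)
    (hB : ∀ t ∈ Set.Icc 0 T, |y t (j + 1) - y' t (j + 1)| ≤ B)
    {t : ℝ} (ht : t ∈ Set.Icc 0 T) :
    y t j - y' t j ≤ ε + (1 / 2) * A + (1 / 2) * B := by
  obtain ⟨hc, -, -, heq, hz, hy, hflat⟩ := hsol
  obtain ⟨-, -, -, heq', hz', hy', -⟩ := hsol'
  have h0T : (0 : ℝ) ∈ Set.Icc 0 T := ⟨le_rfl, ht.1.trans ht.2⟩
  rcases eq_initial_or_exists_zero_eq (hc j hj).2 (hc j hj).1 (fun s hs => hz s hs j hj)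
    (hflat j hj) ht with h | ⟨s, hs, hzs, h⟩
  · have h1 : y' 0 j ≤ y' t j := (hy' j hj).1 h0T ht ht.1
    have h2 := (hy' j hj).2
    have h3 := (hy j hj).2
    have h4 := (abs_nonneg _).trans (hε t ht)
    have h5 := (abs_nonneg _).trans (hA t ht)
    have h6 := (abs_nonneg _).trans (hB t ht)
    linarith
  · have hsT : s ∈ Set.Icc 0 T := ⟨hs.1, hs.2.trans ht.2⟩
    have h1 : y' s j ≤ y' t j := (hy' j hj).1 hsT ht hs.2
    have h2 := heq s hsT j hj
    have h3 := heq' s hsT j hj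
    have h4 := hz' s hsT j hj
    have h5 := (abs_le.1 (hε s hsT)).1
    have h6 := (abs_le.1 (hA s hsT)).2
    have h7 := (abs_le.1 (hB s hsT)).2
    linarith

/-- Comparison of the regulators of two Skorokhod problems, coordinate by coordinate. -/
theorem IsSkorokhodSolution.abs_regulator_sub_le {K : ℕ} {T : ℝ}
    {x x' y y' z z' : ℝ → ℕ → ℝ} (hT : 0 ≤ T)
    (hsol : IsSkorokhodSolution K T x y z) (hsol' : IsSkorokhodSolution K T x' y' z') {ε : ℝ}
    (hε : ∀ t ∈ Set.Icc 0 T, ∀ j ∈ Finset.Icc 1 (K - 1), |x t j - x' t j| ≤ ε)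
    {t : ℝ} (ht : t ∈ Set.Icc 0 T) {j : ℕ} (hj : j ≤ K) :
    |y t j - y' t j| ≤ ε * (j * (K - j)) := by
  have hne : Nonempty (Set.Icc (0 : ℝ) T) := ⟨⟨0, le_rfl, hT⟩⟩
  have hy0 := hsol.2.1
  have hyK := hsol.2.2.1
  have hy0' := hsol'.2.1
  have hyK' := hsol'.2.2.1
  have hcont : ∀ i ≤ K, ContinuousOn (fun t => y t i - y' t i) (Set.Icc 0 T) := by
    intro i hi
    rcases Nat.eq_zero_or_pos i with rfl | hi0
    · simpa [hy0, hy0'] using continuousOn_const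
    rcases hi.eq_or_lt with rfl | hiK
    · simpa [hyK, hyK'] using continuousOn_const
    have hi' : i ∈ Finset.Icc 1 (K - 1) := Finset.mem_Icc.2 ⟨hi0, by omega⟩
    exact (hsol.1 i hi').1.sub (hsol'.1 i hi').1
  set M : ℕ → ℝ := fun i => ⨆ s : Set.Icc (0 : ℝ) T, |y s i - y' s i| with hM
  have hle : ∀ i ≤ K, ∀ s ∈ Set.Icc 0 T, |y s i - y' s i| ≤ M i := fun i hi s hs =>
    abs_le_iSup_abs_of_continuousOn (f := fun s => y s i - y' s i) (hcont i hi) hs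
  have hstep : ∀ i, i + 2 ≤ K → M (i + 1) ≤ ε + (1 / 2) * M i + (1 / 2) * M (i + 2) := by
    intro i hi
    have hi' : i + 1 ∈ Finset.Icc 1 (K - 1) := Finset.mem_Icc.2 ⟨by omega, by omega⟩
    refine ciSup_le fun s => abs_le.2 ⟨?_, ?_⟩
    · have := hsol'.regulator_sub_le hsol hi' (ε := ε) (A := M i) (B := M (i + 2))
        (fun t ht => by rw [abs_sub_comm]; exact hε t ht _ hi')
        (fun t ht => by rw [abs_sub_comm]; exact hle i (by omega) t ht)
        (fun t ht => by rw [abs_sub_comm]; exact hle (i + 2) hi t ht) s.2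
      linarith
    · exact hsol.regulator_sub_le hsol' hi' (fun t ht => hε t ht _ hi')
        (hle i (by omega)) (hle (i + 2) hi) s.2
  have hmax := nonpos_of_midpoint_convex (K := K) (u := fun i => M i - ε * (i * (K - i)))
    (by simp [hM, hy0, hy0']) (by simp [hM, hyK, hyK'])
    (fun i hi => by
      have := hstep i hi
      push_cast
      linarith) j hj
  have := hle j hj t ht
  linarith

/-- the chain of bounds
`‖z−z̃‖_{T,max} ≤ ‖x−x̃‖_{T,max} + 2‖y−ỹ‖_{T,max} ≤ (1+4(K−1)²)‖x−x̃‖_{T,max}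
≤ 5(K−1)²‖x−x̃‖_{T,max}` for the Skorokhod map with reflection matrix `Q^{(K−1)}`. -/
theorem skorokhod_reflected_path_lipschitz_Tmax
    (K : ℕ) (hK : 2 ≤ K) (T : ℝ) (hT : 0 < T)
    (x x' y y' z z' : ℝ → ℕ → ℝ)
    (hx : ∀ j ∈ Finset.Icc 1 (K - 1), ContinuousOn (fun t => x t j) (Set.Icc 0 T))
    (hx' : ∀ j ∈ Finset.Icc 1 (K - 1), ContinuousOn (fun t => x' t j) (Set.Icc 0 T))
    (hx0 : ∀ j ∈ Finset.Icc 1 (K - 1), 0 ≤ x 0 j)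
    (hx0' : ∀ j ∈ Finset.Icc 1 (K - 1), 0 ≤ x' 0 j)
    (hsol : IsSkorokhodSolution K T x y z)
    (hsol' : IsSkorokhodSolution K T x' y' z') :
    normTmax T K (fun t j => z t j - z' t j) ≤
      normTmax T K (fun t j => x t j - x' t j) +
        2 * normTmax T K (fun t j => y t j - y' t j) ∧
    normTmax T K (fun t j => x t j - x' t j) +
        2 * normTmax T K (fun t j => y t j - y' t j) ≤
      (1 + 4 * ((K : ℝ) - 1) ^ 2) * normTmax T K (fun t j => x t j - x' t j) ∧
    (1 + 4 * ((K : ℝ) - 1) ^ 2) * normTmax T K (fun t j => x t j - x' t j) ≤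
      5 * ((K : ℝ) - 1) ^ 2 * normTmax T K (fun t j => x t j - x' t j) := by
  have hc := hsol.1
  have hc' := hsol'.1
  set E := normTmax T K (fun t j => x t j - x' t j)
  set N := normTmax T K (fun t j => y t j - y' t j)
  have hE0 : 0 ≤ E := normTmax_nonneg _ _ _
  have hN0 : 0 ≤ N := normTmax_nonneg _ _ _
  have hE : ∀ t ∈ Set.Icc 0 T, ∀ j ∈ Finset.Icc 1 (K - 1), |x t j - x' t j| ≤ E :=
    fun t ht j hj => abs_le_normTmax (f := fun t j => x t j - x' t j)
      (fun j hj => (hx j hj).sub (hx' j hj)) ht hj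
  have hN : ∀ t ∈ Set.Icc 0 T, ∀ j ≤ K, |y t j - y' t j| ≤ N := by
    intro t ht j hj
    rcases Nat.eq_zero_or_pos j with rfl | hj0
    · simpa [hsol.2.1, hsol'.2.1] using hN0
    rcases hj.eq_or_lt with rfl | hjK
    · simpa [hsol.2.2.1, hsol'.2.2.1] using hN0
    exact abs_le_normTmax (f := fun t j => y t j - y' t j)
      (fun j hj => (hc j hj).1.sub (hc' j hj).1) ht (Finset.mem_Icc.2 ⟨hj0, by omega⟩)
  have hK' : (2 : ℝ) ≤ K := by exact_mod_cast hK
  refine ⟨normTmax_le (by positivity) fun t ht j hj => ?_, ?_, ?_⟩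
  · have hj' := Finset.mem_Icc.1 hj
    have h1 := hsol.2.2.2.1 t ht j hj
    have h2 := hsol'.2.2.2.1 t ht j hj
    have h3 := abs_le.1 (hE t ht j hj)
    have h4 := abs_le.1 (hN t ht j (by omega))
    have h5 := abs_le.1 (hN t ht (j - 1) (by omega))
    have h6 := abs_le.1 (hN t ht (j + 1) (by omega))
    exact abs_le.2 ⟨by linarith, by linarith⟩
  · have hNE : N ≤ E * ((K : ℝ) - 1) ^ 2 := by
      refine normTmax_le (by positivity) fun t ht j hj => ?_
      have hj' := Finset.mem_Icc.1 hj
      refine (hsol.abs_regulator_sub_le hT.le hsol' hE ht (by omega)).trans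
        (mul_le_mul_of_nonneg_left ?_ hE0)
      have h1 : (1 : ℝ) ≤ j := by exact_mod_cast hj'.1
      have h2 : (j : ℝ) + 1 ≤ K := by
        have : j + 1 ≤ K := by omega
        exact_mod_cast this
      rw [sq]
      exact mul_le_mul (by linarith) (by linarith) (by linarith) (by linarith)
    have : 0 ≤ E * ((K : ℝ) - 1) ^ 2 := by positivity
    linarith
  · have h1 : (1 : ℝ) ≤ ((K : ℝ) - 1) ^ 2 := one_le_pow₀ (by linarith)
    exact mul_le_mul_of_nonneg_right (by linarith) hE0
end
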